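/- Let $u\in\mathbb{D}$, $|v|\le 1$, $s>-1$, $r,t>0$ with $0<r+t-s-2<r$. Then there is a constant $C=C(s,r,t)$ such that $\int_{\mathbb{D}}\frac{(1-|z|^2)^s}{|1-\bar u z|^r|1-\bar v z|^t}\,dm(z)\le \frac{C}{(1-|u|^2)^{r+t-s-2}}$. -/

import Mathlib

open MeasureTheory Complex Metric Set

noncomputable section

/-- planar Lebesgue measure normalized so that the unit disc has measure 1 -/
def dA : Measure ℂ := (ENNReal.ofReal Real.pi)⁻¹ • volume

/-- the open unit disc -/
def unitDisc : Set ℂ := Metric.ball (0 : ℂ) 1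

/-- the disc automorphism exchanging 0 and a -/
def mobius (a z : ℂ) : ℂ := (a - z) / (1 - (starRingEnd ℂ) a * z)

/-- weighted Dirichlet energy of the hyperbolic translate of `f` by `a`:
`∫_𝔻 |f'(z)|² (1-|φ_a(z)|²)^p dm(z)` -/
def dirEnergy (p : ℝ) (a : ℂ) (f : ℂ → ℂ) : ℝ :=
  ∫ z in unitDisc, ‖deriv f z‖ ^ 2 * (1 - ‖mobius a z‖ ^ 2) ^ p ∂dA

/-- Carleson box over the arc of center `e^{iθ}` and normalized length `h` -/
def carlesonBox (θ h : ℝ) : Set ℂ :=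
  {z | z ∈ unitDisc ∧ 1 - h ≤ ‖z‖ ∧
    ∃ t : ℝ, |t| ≤ Real.pi * h ∧ z = (‖z‖ : ℂ) * Complex.exp (Complex.I * (θ + t))}

/-- the box energy `∫_{S(I)} |f'(z)|² (1-|z|²)^p dm(z)` -/
def boxEnergy (p θ h : ℝ) (f : ℂ → ℂ) : ℝ :=
  ∫ z in carlesonBox θ h, ‖deriv f z‖ ^ 2 * (1 - ‖z‖ ^ 2) ^ p ∂dA

/-- membership in the Dirichlet–Morrey space `𝒟_p^λ` -/
def memDM (p lam : ℝ) (f : ℂ → ℂ) : Prop :=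
  AnalyticOn ℂ f unitDisc ∧
    ∃ C : ℝ, ∀ a ∈ unitDisc, (1 - ‖a‖ ^ 2) ^ (p * (1 - lam)) * dirEnergy p a f ≤ C

/-- the Dirichlet–Morrey norm `|f(0)| + sup_a (1-|a|²)^{p(1-λ)/2} ‖f∘φ_a - f(a)‖_{𝒟_p}` -/
def dmNorm (p lam : ℝ) (f : ℂ → ℂ) : ℝ :=
  ‖f 0‖ + ⨆ a : unitDisc, (1 - ‖(a : ℂ)‖ ^ 2) ^ (p * (1 - lam) / 2) *
    (dirEnergy p (a : ℂ) f) ^ (1 / 2 : ℝ)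

/-- square of the weighted Dirichlet norm -/
def dpNormSq (p : ℝ) (f : ℂ → ℂ) : ℝ :=
  ‖f 0‖ ^ 2 + ∫ z in unitDisc, ‖deriv f z‖ ^ 2 * (1 - ‖z‖ ^ 2) ^ p ∂dA

/-- membership in the weighted Dirichlet space `𝒟_p` -/
def memDp (p : ℝ) (f : ℂ → ℂ) : Prop :=
  AnalyticOn ℂ f unitDisc ∧
    IntegrableOn (fun z => ‖deriv f z‖ ^ 2 * (1 - ‖z‖ ^ 2) ^ p) unitDisc dA

/-- the integration operator `I_g(f)(z) = ∫₀^z f'(w) g(w) dw` -/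
def Iop (g f : ℂ → ℂ) (z : ℂ) : ℂ :=
  ∫ t in (0 : ℝ)..1, deriv f ((t : ℂ) * z) * g ((t : ℂ) * z) * z

/-- the integration operator `J_g(f)(z) = ∫₀^z f(w) g'(w) dw` -/
def Jop (g f : ℂ → ℂ) (z : ℂ) : ℂ :=
  ∫ t in (0 : ℝ)..1, f ((t : ℂ) * z) * deriv g ((t : ℂ) * z) * z

lemma lintegral_Ioi_rpow {a c : ℝ} (ha : 0 < a) (hc : c < -1) :
    ∫⁻ x in Ioi a, ENNReal.ofReal (x ^ c) = ENNReal.ofReal (-a ^ (c + 1) / (c + 1)) := by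
  rw [← integral_Ioi_rpow_of_lt hc ha, ofReal_integral_eq_lintegral_ofReal
    (integrableOn_Ioi_rpow_of_lt hc ha)]
  filter_upwards [ae_restrict_mem measurableSet_Ioi] with x hx
  exact Real.rpow_nonneg (ha.trans hx).le c

lemma lintegral_Ioc_rpow {a c : ℝ} (ha : 0 ≤ a) (hc : -1 < c) :
    ∫⁻ x in Ioc 0 a, ENNReal.ofReal (x ^ c) = ENNReal.ofReal (a ^ (c + 1) / (c + 1)) := by
  have h := integral_rpow (a := 0) (b := a) (Or.inl hc)
  rw [Real.zero_rpow (by linarith), sub_zero, intervalIntegral.integral_of_le ha] at h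
  have hi := (intervalIntegral.intervalIntegrable_rpow' (a := 0) (b := a) hc).1
  rw [← h, ofReal_integral_eq_lintegral_ofReal hi]
  filter_upwards [ae_restrict_mem measurableSet_Ioc] with x hx
  exact Real.rpow_nonneg hx.1.le c

lemma lintegral_rpow_neg_eq {X : Type*} [MeasurableSpace X] {ν : Measure X} [SFinite ν]
    {f : X → ℝ} (hf : Measurable f) (hpos : ∀ᵐ x ∂ν, 0 < f x) {p : ℝ} (hp : 0 < p) :
    ∫⁻ x, ENNReal.ofReal (f x ^ (-p)) ∂ν =
      ∫⁻ σ in Ioi (0 : ℝ), ENNReal.ofReal (p * σ ^ (-p - 1)) * ν {x | f x < σ} := by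
  have hmeas : MeasurableSet {q : X × ℝ | f q.1 < q.2} :=
    measurableSet_lt (hf.comp measurable_fst) measurable_snd
  have hF : Measurable fun q : X × ℝ =>
      {q : X × ℝ | f q.1 < q.2}.indicator (fun q => ENNReal.ofReal (p * q.2 ^ (-p - 1))) q :=
    Measurable.indicator (by fun_prop) hmeas
  calc ∫⁻ x, ENNReal.ofReal (f x ^ (-p)) ∂ν
      = ∫⁻ x, (∫⁻ σ in Ioi (0 : ℝ), {q : X × ℝ | f q.1 < q.2}.indicator
          (fun q => ENNReal.ofReal (p * q.2 ^ (-p - 1))) (x, σ)) ∂ν := by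
        refine lintegral_congr_ae ?_
        filter_upwards [hpos] with x hx
        have h1 : ∀ σ : ℝ, {q : X × ℝ | f q.1 < q.2}.indicator
            (fun q => ENNReal.ofReal (p * q.2 ^ (-p - 1))) (x, σ) =
            (Ioi (f x)).indicator (fun σ => ENNReal.ofReal (p * σ ^ (-p - 1))) σ := by
          intro σ
          simp [indicator]
        simp_rw [h1]
        rw [setLIntegral_indicator measurableSet_Ioi,
          inter_eq_left.2 (Ioi_subset_Ioi hx.le)]
        simp_rw [ENNReal.ofReal_mul hp.le]
        rw [lintegral_const_mul' _ _ ENNReal.ofReal_ne_top,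
          lintegral_Ioi_rpow hx (by linarith), ← ENNReal.ofReal_mul hp.le]
        congr 1
        rw [sub_add_cancel]
        field_simp
    _ = ∫⁻ σ in Ioi (0 : ℝ), ∫⁻ x, {q : X × ℝ | f q.1 < q.2}.indicator
          (fun q => ENNReal.ofReal (p * q.2 ^ (-p - 1))) (x, σ) ∂ν :=
        lintegral_lintegral_swap hF.aemeasurable
    _ = _ := by
        refine lintegral_congr fun σ => ?_
        rw [← lintegral_indicator_const (measurableSet_lt hf measurable_const)]
        rfl

lemma lintegral_rpow_neg_le_of_measure_le_min {X : Type*} [MeasurableSpace X] {ν : Measure X}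
    [SFinite ν] {f : X → ℝ} (hf : Measurable f) (hpos : ∀ᵐ x ∂ν, 0 < f x) {M p q ρ : ℝ}
    (hM : 0 ≤ M) (hp : 0 < p) (hpq : p < q) (hρ : 0 < ρ)
    (hν : ∀ σ > 0, ν {x | f x < σ} ≤ ENNReal.ofReal (M * σ ^ q))
    (huniv : ν univ ≤ ENNReal.ofReal (M * ρ ^ q)) :
    ∫⁻ x, ENNReal.ofReal (f x ^ (-p)) ∂ν ≤
      ENNReal.ofReal (M * (p / (q - p) + 1) * ρ ^ (q - p)) := by
  have hq : 0 < q - p := sub_pos.2 hpq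
  rw [lintegral_rpow_neg_eq hf hpos hp, ← Ioc_union_Ioi_eq_Ioi hρ.le]
  refine (lintegral_union_le _ _ _).trans ?_
  have e : M * (p / (q - p) + 1) * ρ ^ (q - p) =
      p * M * (ρ ^ (q - p - 1 + 1) / (q - p - 1 + 1)) +
        (M * ρ ^ q * p) * (-ρ ^ (-p - 1 + 1) / (-p - 1 + 1)) := by
    have : ρ ^ q = ρ ^ (q - p) * ρ ^ p := by rw [← Real.rpow_add hρ]; congr 1; ring
    rw [this, sub_add_cancel, sub_add_cancel, Real.rpow_neg hρ.le]
    have := Real.rpow_pos_of_pos hρ p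
    field_simp
  have hn : 0 ≤ -ρ ^ (-p - 1 + 1) / (-p - 1 + 1) := by
    rw [sub_add_cancel, neg_div_neg_eq]; positivity
  rw [e, ENNReal.ofReal_add (by rw [sub_add_cancel]; positivity) (by positivity)]
  refine add_le_add ?_ ?_
  · rw [ENNReal.ofReal_mul (by positivity), ← lintegral_Ioc_rpow hρ.le (by linarith),
      ← lintegral_const_mul' _ _ ENNReal.ofReal_ne_top]
    refine setLIntegral_mono' measurableSet_Ioc fun σ hσ => ?_
    refine (mul_le_mul_right (hν σ hσ.1) _).trans_eq ?_
    have hσ0 := hσ.1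
    rw [← ENNReal.ofReal_mul (by positivity), ← ENNReal.ofReal_mul (by positivity)]
    congr 1
    have : σ ^ (q - p - 1) = σ ^ q * σ ^ (-p - 1) := by
      rw [← Real.rpow_add hσ0]; congr 1; ring
    rw [this]; ring
  · rw [ENNReal.ofReal_mul (by positivity), ← lintegral_Ioi_rpow hρ (by linarith),
      ← lintegral_const_mul' _ _ ENNReal.ofReal_ne_top]
    refine setLIntegral_mono' measurableSet_Ioi fun σ hσ => ?_
    have hσ0 : 0 < σ := hρ.trans hσ
    refine (mul_le_mul_right ((measure_mono (subset_univ _)).trans huniv) _).trans_eq ?_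
    rw [← ENNReal.ofReal_mul (by positivity), ← ENNReal.ofReal_mul (by positivity)]
    congr 1
    ring

lemma lintegral_rpow_neg_le_of_le {X : Type*} [MeasurableSpace X] {ν : Measure X}
    [SFinite ν] {f : X → ℝ} (hf : Measurable f) {M p q δ : ℝ} (hM : 0 ≤ M)
    (hp : 0 < p) (hqp : q < p) (hδ : 0 < δ) (hle : ∀ᵐ x ∂ν, δ ≤ f x)
    (hν : ∀ σ > 0, ν {x | f x < σ} ≤ ENNReal.ofReal (M * σ ^ q)) :
    ∫⁻ x, ENNReal.ofReal (f x ^ (-p)) ∂ν ≤ ENNReal.ofReal (M * p / (p - q) * δ ^ (q - p)) := by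
  have hq : 0 < p - q := sub_pos.2 hqp
  have hzero : ∀ σ ≤ δ, ν {x | f x < σ} = 0 := by
    intro σ hσ
    refine measure_mono_null (fun x hx => ?_) (ae_iff.1 hle)
    exact not_le.2 (lt_of_lt_of_le hx hσ)
  rw [lintegral_rpow_neg_eq hf (hle.mono fun x hx => hδ.trans_le hx) hp,
    ← Ioc_union_Ioi_eq_Ioi hδ.le]
  refine (lintegral_union_le _ _ _).trans ?_
  have e : M * p / (p - q) * δ ^ (q - p) =
      M * p * (-δ ^ (q - p - 1 + 1) / (q - p - 1 + 1)) := by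
    rw [sub_add_cancel, ← neg_sub p q, neg_div_neg_eq]; ring
  have h0 : ∫⁻ σ in Ioc 0 δ, ENNReal.ofReal (p * σ ^ (-p - 1)) * ν {x | f x < σ} = 0 := by
    rw [setLIntegral_congr_fun (g := fun _ => 0) measurableSet_Ioc]
    · simp
    · intro σ hσ
      simp [hzero σ hσ.2]
  rw [h0, zero_add, e, ENNReal.ofReal_mul (by positivity),
    ← lintegral_Ioi_rpow hδ (by linarith), ← lintegral_const_mul' _ _ ENNReal.ofReal_ne_top]
  refine setLIntegral_mono' measurableSet_Ioi fun σ hσ => ?_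
  have hσ0 : 0 < σ := hδ.trans hσ
  refine (mul_le_mul_right (hν σ hσ0) _).trans_eq ?_
  rw [← ENNReal.ofReal_mul (by positivity), ← ENNReal.ofReal_mul (by positivity)]
  congr 1
  have : σ ^ (q - p - 1) = σ ^ q * σ ^ (-p - 1) := by
    rw [← Real.rpow_add hσ0]; congr 1; ring
  rw [this]; ring

/-- If the sublevel sets of `f ≥ δ` and `g > 0` both have `ν`-measure `O(σ ^ q)` with
`t < q < r + t`, then `∫ f ^ (-r) * g ^ (-t) ∂ν = O(δ ^ (q - t - r))`. -/
lemma lintegral_rpow_neg_mul_rpow_neg_le {X : Type*} [MeasurableSpace X] {ν : Measure X}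
    [SFinite ν] {f g : X → ℝ} (hf : Measurable f) (hg : Measurable g)
    {M r t q δ : ℝ} (hM : 0 ≤ M) (hr : 0 < r) (ht : 0 < t) (htq : t < q) (hqrt : q < r + t)
    (hδ : 0 < δ) (hle : ∀ᵐ x ∂ν, δ ≤ f x) (hpos : ∀ᵐ x ∂ν, 0 < g x)
    (hνf : ∀ σ > 0, ν {x | f x < σ} ≤ ENNReal.ofReal (M * σ ^ q))
    (hνg : ∀ σ > 0, ν {x | g x < σ} ≤ ENNReal.ofReal (M * σ ^ q)) :
    ∫⁻ x, ENNReal.ofReal (g x ^ (-t)) * ENNReal.ofReal (f x ^ (-r)) ∂ν ≤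
      ENNReal.ofReal (M * (t / (q - t) + 1) * r / (r - (q - t)) * δ ^ (q - t - r)) := by
  have hq : 0 < q - t := sub_pos.2 htq
  have hd : Measurable fun x => ENNReal.ofReal (g x ^ (-t)) := by fun_prop
  have hd' : Measurable fun x => ENNReal.ofReal (f x ^ (-r)) := by fun_prop
  have key := lintegral_rpow_neg_le_of_le (ν := ν.withDensity fun x => ENNReal.ofReal (g x ^ (-t)))
    hf (M := M * (t / (q - t) + 1)) (p := r) (q := q - t) (by positivity) hr (by linarith) hδ
    ((withDensity_absolutelyContinuous _ _).ae_le hle) ?_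
  · rwa [lintegral_withDensity_eq_lintegral_mul _ hd hd'] at key
  intro σ hσ
  have hS : MeasurableSet {x | f x < σ} := measurableSet_lt hf measurable_const
  rw [withDensity_apply _ hS]
  refine lintegral_rpow_neg_le_of_measure_le_min hg (ae_restrict_of_ae hpos) hM ht htq hσ
    (fun τ hτ => (Measure.restrict_apply_le _ _).trans (hνg τ hτ)) ?_
  rw [Measure.restrict_apply_univ]
  exact hνf σ hσ

lemma setLIntegral_one_sub_normSq_rpow_le {s ρ : ℝ} (hs : -1 < s) (hρ : 0 < ρ) :
    ∫⁻ z in ball (0 : ℂ) 1 ∩ {z | ‖1 - z‖ < ρ}, ENNReal.ofReal ((1 - ‖z‖ ^ 2) ^ s) ≤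
      ENNReal.ofReal (2 * Real.pi * 2 ^ |s| / (s + 1) * ρ ^ (s + 2)) := by
  have hs1 : 0 < s + 1 := by linarith
  have hπ := Real.pi_pos
  have hmeas : MeasurableSet (ball (0 : ℂ) 1 ∩ {z | ‖1 - z‖ < ρ}) :=
    measurableSet_ball.inter (measurableSet_lt (by fun_prop) measurable_const)
  set G : ℝ → ENNReal :=
    (Ico (1 - ρ) 1).indicator fun x => ENNReal.ofReal (2 ^ |s| * (1 - x) ^ s) with hG
  have hGm : Measurable G := Measurable.indicator (by fun_prop) measurableSet_Ico
  set H : ℝ → ENNReal := (Icc (-(Real.pi * ρ)) (Real.pi * ρ)).indicator fun _ => 1 with hH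
  have hHm : Measurable H := Measurable.indicator measurable_const measurableSet_Icc
  rw [← lintegral_indicator hmeas, ← Complex.lintegral_comp_polarCoord_symm]
  have hpt : ∀ p ∈ polarCoord.target, ENNReal.ofReal p.1 •
      (ball (0 : ℂ) 1 ∩ {z | ‖1 - z‖ < ρ}).indicator
        (fun z => ENNReal.ofReal ((1 - ‖z‖ ^ 2) ^ s)) (Complex.polarCoord.symm p) ≤
      G p.1 * H p.2 := by
    rintro ⟨x, θ⟩ ⟨hx, hθ⟩
    simp only [mem_Ioi, mem_Ioo] at hx hθ
    by_cases hz : Complex.polarCoord.symm (x, θ) ∈ ball (0 : ℂ) 1 ∩ {z | ‖1 - z‖ < ρ}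
    swap
    · rw [indicator_of_notMem hz, smul_zero]
      exact zero_le
    have hnorm : ‖Complex.polarCoord.symm (x, θ)‖ = x := by
      rw [Complex.norm_polarCoord_symm, abs_of_pos hx]
    have hexp : Complex.polarCoord.symm (x, θ) = x * Complex.exp (I * θ) := by
      rw [Complex.polarCoord_symm_apply, mul_comm I, Complex.exp_mul_I]
      push_cast
      rfl
    rw [indicator_of_mem hz, hnorm]
    obtain ⟨hz1, hz2⟩ := hz
    rw [mem_ball_zero_iff, hnorm] at hz1
    have h1x : 1 - x ≤ ‖1 - Complex.polarCoord.symm (x, θ)‖ := by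
      have := norm_sub_norm_le (1 : ℂ) (Complex.polarCoord.symm (x, θ))
      rwa [norm_one, hnorm] at this
    have hxρ : 1 - x < ρ := h1x.trans_lt hz2
    have hang : |θ| ≤ Real.pi * ρ := by
      have e1 : ‖Complex.exp (I * θ) - 1‖ ≤ 2 * ρ := by
        have e2 : ‖Complex.exp (I * θ) - Complex.polarCoord.symm (x, θ)‖ = 1 - x := by
          rw [hexp, ← one_sub_mul, norm_mul, mul_comm I, Complex.norm_exp_ofReal_mul_I, mul_one]
          rw [← ofReal_one, ← ofReal_sub, norm_real, Real.norm_of_nonneg (by linarith)]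
        have e3 := norm_sub_le_norm_sub_add_norm_sub (Complex.exp (I * θ))
          (Complex.polarCoord.symm (x, θ)) 1
        rw [norm_sub_rev (Complex.polarCoord.symm (x, θ)) 1, e2] at e3
        have : ‖1 - Complex.polarCoord.symm (x, θ)‖ < ρ := hz2
        linarith
      rw [Complex.norm_exp_I_mul_ofReal_sub_one, Real.norm_eq_abs, abs_mul, abs_two] at e1
      have e4 := Real.mul_abs_le_abs_sin (x := θ / 2) (by
        rw [abs_div, abs_two]; linarith [abs_le.2 ⟨hθ.1.le, hθ.2.le⟩])
      rw [abs_div, abs_two] at e4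
      have e5 : 2 / Real.pi * (|θ| / 2) ≤ ρ := by linarith
      calc |θ| = Real.pi * (2 / Real.pi * (|θ| / 2)) := by field_simp
        _ ≤ Real.pi * ρ := by gcongr
    rw [hG, hH, indicator_of_mem (show x ∈ Ico (1 - ρ) 1 from ⟨by linarith, hz1⟩),
      indicator_of_mem (show θ ∈ Icc (-(Real.pi * ρ)) (Real.pi * ρ) from abs_le.1 hang),
      mul_one, smul_eq_mul, ← ENNReal.ofReal_mul hx.le]
    refine ENNReal.ofReal_le_ofReal ?_
    have hfac : (1 - x ^ 2) ^ s = (1 + x) ^ s * (1 - x) ^ s := by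
      rw [← Real.mul_rpow (by linarith) (by linarith)]; ring_nf
    have hb : (1 + x) ^ s ≤ 2 ^ |s| :=
      (Real.rpow_le_rpow_of_exponent_le (by linarith) (le_abs_self s)).trans
        (Real.rpow_le_rpow (by linarith) (by linarith) (abs_nonneg s))
    have hc : 0 ≤ (1 - x) ^ s := Real.rpow_nonneg (by linarith) s
    have hd : 0 ≤ (1 - x ^ 2) ^ s := Real.rpow_nonneg (by nlinarith) s
    calc x * (1 - x ^ 2) ^ s ≤ 1 * (1 - x ^ 2) ^ s := by gcongr
      _ = (1 + x) ^ s * (1 - x) ^ s := by rw [one_mul, hfac]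
      _ ≤ 2 ^ |s| * (1 - x) ^ s := by gcongr
  have hGint : ∫⁻ x, G x = ENNReal.ofReal (2 ^ |s| * (ρ ^ (s + 1) / (s + 1))) := by
    rw [← lintegral_sub_left_eq_self _ 1]
    have : (fun x => G (1 - x)) =
        (Ioc 0 ρ).indicator fun x => ENNReal.ofReal (2 ^ |s| * x ^ s) := by
      funext x
      by_cases hx : x ∈ Ioc 0 ρ
      · have hx' : 1 - x ∈ Ico (1 - ρ) 1 := ⟨by linarith [hx.2], by linarith [hx.1]⟩
        rw [indicator_of_mem hx, hG, indicator_of_mem hx', sub_sub_cancel]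
      · rw [indicator_of_notMem hx, hG, indicator_of_notMem]
        exact fun h => hx ⟨by linarith [h.2], by linarith [h.1]⟩
    rw [this, lintegral_indicator measurableSet_Ioc]
    simp_rw [ENNReal.ofReal_mul (by positivity : (0 : ℝ) ≤ 2 ^ |s|)]
    rw [lintegral_const_mul' _ _ ENNReal.ofReal_ne_top, lintegral_Ioc_rpow hρ.le hs]
  have hHint : ∫⁻ x, H x = ENNReal.ofReal (2 * Real.pi * ρ) := by
    rw [hH, lintegral_indicator_const measurableSet_Icc, one_mul, Real.volume_Icc]
    ring_nf
  calc _ ≤ ∫⁻ p in polarCoord.target, G p.1 * H p.2 :=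
        setLIntegral_mono' polarCoord.open_target.measurableSet hpt
    _ ≤ ∫⁻ p : ℝ × ℝ, G p.1 * H p.2 := setLIntegral_le_lintegral _ _
    _ = (∫⁻ x, G x) * ∫⁻ x, H x :=
        lintegral_prod_mul hGm.aemeasurable hHm.aemeasurable
    _ = _ := by
        rw [hGint, hHint, ← ENNReal.ofReal_mul (by positivity)]
        congr 1
        rw [show s + 2 = s + 1 + 1 by ring, Real.rpow_add_one hρ.ne' (s + 1)]
        ring

lemma setLIntegral_one_sub_normSq_rpow_circle_le {s ρ : ℝ} (hs : -1 < s) (hρ : 0 < ρ)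
    (ω : Circle) :
    ∫⁻ z in ball (0 : ℂ) 1 ∩ {z | ‖1 - (starRingEnd ℂ) ω * z‖ < ρ},
        ENNReal.ofReal ((1 - ‖z‖ ^ 2) ^ s) ≤
      ENNReal.ofReal (2 * Real.pi * 2 ^ |s| / (s + 1) * ρ ^ (s + 2)) := by
  have hmeas : MeasurableSet (ball (0 : ℂ) 1 ∩ {z | ‖1 - z‖ < ρ}) :=
    measurableSet_ball.inter (measurableSet_lt (by fun_prop) measurable_const)
  refine le_trans (le_of_eq ?_) (setLIntegral_one_sub_normSq_rpow_le hs hρ)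
  rw [← (rotation ω⁻¹).measurePreserving.setLIntegral_comp_preimage hmeas (by fun_prop)]
  have hset : ball (0 : ℂ) 1 ∩ {z | ‖1 - (starRingEnd ℂ) ω * z‖ < ρ} =
      rotation ω⁻¹ ⁻¹' (ball (0 : ℂ) 1 ∩ {z | ‖1 - z‖ < ρ}) := by
    ext z
    simp only [mem_inter_iff, mem_preimage, mem_ball_zero_iff, mem_ofPred_eq,
      rotation_apply, Circle.coe_inv_eq_conj, norm_mul ((starRingEnd ℂ) (ω : ℂ)),
      RCLike.norm_conj, Circle.norm_coe, one_mul]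
  rw [hset]
  simp_rw [LinearIsometryEquiv.norm_map]

lemma one_sub_norm_le_norm_one_sub_conj_mul {w z : ℂ} (hz : ‖z‖ ≤ 1) :
    1 - ‖w‖ ≤ ‖1 - (starRingEnd ℂ) w * z‖ := by
  have h := norm_sub_norm_le (1 : ℂ) ((starRingEnd ℂ) w * z)
  rw [norm_one, norm_mul, RCLike.norm_conj] at h
  linarith [mul_le_of_le_one_right (norm_nonneg w) hz]

lemma setLIntegral_one_sub_normSq_rpow_closedBall_le {s ρ : ℝ} (hs : -1 < s) (hρ : 0 < ρ)
    {w : ℂ} (hw : ‖w‖ ≤ 1) :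
    ∫⁻ z in ball (0 : ℂ) 1 ∩ {z | ‖1 - (starRingEnd ℂ) w * z‖ < ρ},
        ENNReal.ofReal ((1 - ‖z‖ ^ 2) ^ s) ≤
      ENNReal.ofReal (2 * Real.pi * 2 ^ |s| / (s + 1) * 2 ^ (s + 2) * ρ ^ (s + 2)) := by
  have hw' : w = ‖w‖ * (Circle.exp w.arg : ℂ) := by
    rw [Circle.coe_exp, Complex.norm_mul_exp_arg_mul_I]
  have h := setLIntegral_one_sub_normSq_rpow_circle_le hs (mul_pos two_pos hρ)
    (Circle.exp w.arg)
  rw [Real.mul_rpow zero_le_two hρ.le, ← mul_assoc] at h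
  refine (lintegral_mono_set ?_).trans h
  rintro z ⟨hz, hzρ⟩
  refine ⟨hz, ?_⟩
  simp only [mem_ofPred_eq, mem_ball_zero_iff] at hz hzρ ⊢
  set ω : Circle := Circle.exp w.arg
  have hdist : ‖(starRingEnd ℂ) w * z - (starRingEnd ℂ) (ω : ℂ) * z‖ ≤ 1 - ‖w‖ := by
    have : (starRingEnd ℂ) w * z - (starRingEnd ℂ) (ω : ℂ) * z =
        -(((1 - ‖w‖ : ℝ) : ℂ) * ((starRingEnd ℂ) (ω : ℂ) * z)) := by
      conv_lhs => rw [hw', map_mul, Complex.conj_ofReal]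
      push_cast
      ring
    rw [this, norm_neg, norm_mul, norm_mul, RCLike.norm_conj, Circle.norm_coe, one_mul,
      norm_real, Real.norm_of_nonneg (by linarith)]
    exact mul_le_of_le_one_right (by linarith) hz.le
  have hlow : 1 - ‖w‖ ≤ ‖1 - (starRingEnd ℂ) w * z‖ := one_sub_norm_le_norm_one_sub_conj_mul hz.le
  have htri := norm_sub_le_norm_sub_add_norm_sub 1 ((starRingEnd ℂ) w * z)
    ((starRingEnd ℂ) (ω : ℂ) * z)
  linarith

/-- Integral estimate (Ortega–Fàbrega / Zhao type lemma). -/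
theorem stmt_6 (s r t : ℝ) (hs : -1 < s) (hr : 0 < r) (ht : 0 < t)
    (h1 : 0 < r + t - s - 2) (h2 : r + t - s - 2 < r) :
    ∃ C : ℝ, 0 < C ∧ ∀ u v : ℂ, ‖u‖ < 1 → ‖v‖ ≤ 1 →
      (∫ z in unitDisc,
          (1 - ‖z‖ ^ 2) ^ s /
            (‖1 - (starRingEnd ℂ) u * z‖ ^ r * ‖1 - (starRingEnd ℂ) v * z‖ ^ t) ∂dA) ≤
        C / (1 - ‖u‖ ^ 2) ^ (r + t - s - 2) := by
  set q : ℝ := s + 2 with hq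
  set M : ℝ := 2 * Real.pi * 2 ^ |s| / (s + 1) * 2 ^ (s + 2) with hMdef
  have hs1 : 0 < s + 1 := by linarith
  have hπ := Real.pi_pos
  have hM : 0 < M := by positivity
  have htq : 0 < q - t := by linarith
  have hrq : 0 < r - (q - t) := by linarith
  set K : ℝ := M * (t / (q - t) + 1) * r / (r - (q - t)) with hK
  have hKpos : 0 < K := by positivity
  refine ⟨K * 2 ^ (r + t - s - 2), by positivity, fun u v hu hv => ?_⟩
  have hδ : 0 < 1 - ‖u‖ := sub_pos.2 hu
  set h : ℂ → ENNReal := fun z => ENNReal.ofReal ((1 - ‖z‖ ^ 2) ^ s) with hh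
  have hhm : Measurable h := by fun_prop
  set f : ℂ → ℝ := fun z => ‖1 - (starRingEnd ℂ) u * z‖ with hf
  set g : ℂ → ℝ := fun z => ‖1 - (starRingEnd ℂ) v * z‖ with hg
  have hfm : Measurable f := by fun_prop
  have hgm : Measurable g := by fun_prop
  have hfpos : ∀ z ∈ unitDisc, 1 - ‖u‖ ≤ f z := fun z hz =>
    one_sub_norm_le_norm_one_sub_conj_mul (mem_ball_zero_iff.1 hz).le
  have hgpos : ∀ z ∈ unitDisc, 0 < g z := by
    intro z hz
    have hz1 : ‖z‖ < 1 := mem_ball_zero_iff.1 hz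
    have h2 := norm_sub_norm_le (1 : ℂ) ((starRingEnd ℂ) v * z)
    rw [norm_one, norm_mul, RCLike.norm_conj] at h2
    have h3 := mul_le_of_le_one_left (norm_nonneg z) hv
    exact lt_of_lt_of_le (by linarith) h2
  have hD : MeasurableSet unitDisc := measurableSet_ball
  set ν : Measure ℂ := (volume.restrict unitDisc).withDensity h with hν
  have hmem : ∀ᵐ z ∂ν, z ∈ unitDisc :=
    (withDensity_absolutelyContinuous _ _).ae_le (ae_restrict_mem hD)
  have hνle : ∀ w : ℂ, ‖w‖ ≤ 1 → ∀ σ > 0,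
      ν {z | ‖1 - (starRingEnd ℂ) w * z‖ < σ} ≤ ENNReal.ofReal (M * σ ^ q) := by
    intro w hw σ hσ
    have hS : MeasurableSet {z : ℂ | ‖1 - (starRingEnd ℂ) w * z‖ < σ} :=
      measurableSet_lt (by fun_prop) measurable_const
    rw [hν, withDensity_apply _ hS, Measure.restrict_restrict hS, inter_comm]
    exact setLIntegral_one_sub_normSq_rpow_closedBall_le hs hσ hw
  have key := lintegral_rpow_neg_mul_rpow_neg_le hfm hgm hM.le hr ht (by linarith)
    (by linarith : q < r + t) hδ (hmem.mono hfpos) (hmem.mono hgpos) (hνle u hu.le) (hνle v hv)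
  rw [hν, lintegral_withDensity_eq_lintegral_mul _ hhm (by fun_prop)] at key
  have hbound : ∫⁻ z in unitDisc, ENNReal.ofReal ‖(1 - ‖z‖ ^ 2) ^ s / (f z ^ r * g z ^ t)‖ ∂dA ≤
      ENNReal.ofReal (K * (1 - ‖u‖) ^ (q - t - r)) := by
    rw [dA, Measure.restrict_smul, lintegral_smul_measure, smul_eq_mul]
    have hc : (ENNReal.ofReal Real.pi)⁻¹ ≤ 1 := by
      rw [ENNReal.inv_le_one, ENNReal.one_le_ofReal]
      linarith [Real.pi_gt_three]
    refine (mul_le_of_le_one_left (zero_le) hc).trans (le_trans (le_of_eq ?_) key)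
    refine setLIntegral_congr_fun hD fun z hz => ?_
    have hz1 : ‖z‖ < 1 := mem_ball_zero_iff.1 hz
    have hw : 0 ≤ (1 - ‖z‖ ^ 2) ^ s := Real.rpow_nonneg (by nlinarith [norm_nonneg z]) s
    have hfz : 0 < f z := hδ.trans_le (hfpos z hz)
    have hgz : 0 < g z := hgpos z hz
    simp only [Pi.mul_apply, hh]
    rw [← ENNReal.ofReal_mul (by positivity), ← ENNReal.ofReal_mul hw,
      Real.norm_of_nonneg (by positivity), Real.rpow_neg hfz.le, Real.rpow_neg hgz.le]
    congr 1
    field_simp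
  have hα : q - t - r = -(r + t - s - 2) := by rw [hq]; ring
  have hu2 : 0 < 1 - ‖u‖ ^ 2 := by nlinarith [norm_nonneg u]
  calc _ ≤ K * (1 - ‖u‖) ^ (q - t - r) :=
        (Real.le_norm_self _).trans <| (norm_integral_le_lintegral_norm _).trans <|
          ENNReal.toReal_le_of_le_ofReal (by positivity) hbound
    _ = K / (1 - ‖u‖) ^ (r + t - s - 2) := by rw [hα, Real.rpow_neg hδ.le, div_eq_mul_inv]
    _ ≤ _ := by
        rw [div_le_div_iff₀ (by positivity) (by positivity), mul_assoc]
        gcongr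
        rw [← Real.mul_rpow zero_le_two hδ.le]
        exact Real.rpow_le_rpow hu2.le (by nlinarith [norm_nonneg u]) h1.le
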